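/- arXiv:2412.20509 — 7 statements merged into one kernel-verified Lean document; each statement's English description precedes it below -/
import Mathlib

section
/- Let X be a real n×p matrix such that XᵀX is invertible, and let Z be a real m×q matrix such that ZᵀZ is invertible. Let B₁, B₂ be m×p matrices, Γ₁, Γ₂ be n×q matrices with XᵀΓ₁ = 0 and XᵀΓ₂ = 0, U₁, U₂ be n×d matrices with XᵀU₁ = 0 and XᵀU₂ = 0, and V₁, V₂ be m×d matrices with ZᵀV₁ = 0 and ZᵀV₂ = 0. If X B₁ᵀ + Γ₁ Zᵀ + U₁ V₁ᵀ = X B₂ᵀ + Γ₂ Zᵀ + U₂ V₂ᵀ, then B₁ = B₂, Γ₁ = Γ₂, and U₁ V₁ᵀ = U₂ V₂ᵀ. -/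
open Matrix

theorem gmf_identifiability_under_A
    {n m p q d : ℕ}
    (X : Matrix (Fin n) (Fin p) ℝ) (Z : Matrix (Fin m) (Fin q) ℝ)
    (hX : IsUnit (Xᵀ * X)) (hZ : IsUnit (Zᵀ * Z))
    (B₁ B₂ : Matrix (Fin m) (Fin p) ℝ)
    (Γ₁ Γ₂ : Matrix (Fin n) (Fin q) ℝ)
    (U₁ U₂ : Matrix (Fin n) (Fin d) ℝ)
    (V₁ V₂ : Matrix (Fin m) (Fin d) ℝ)
    (hΓ₁ : Xᵀ * Γ₁ = 0) (hΓ₂ : Xᵀ * Γ₂ = 0)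
    (hU₁ : Xᵀ * U₁ = 0) (hU₂ : Xᵀ * U₂ = 0)
    (hV₁ : Zᵀ * V₁ = 0) (hV₂ : Zᵀ * V₂ = 0)
    (heq : X * B₁ᵀ + Γ₁ * Zᵀ + U₁ * V₁ᵀ = X * B₂ᵀ + Γ₂ * Zᵀ + U₂ * V₂ᵀ) :
    B₁ = B₂ ∧ Γ₁ = Γ₂ ∧ U₁ * V₁ᵀ = U₂ * V₂ᵀ := by
  have hXd := (Matrix.isUnit_iff_isUnit_det _).1 hX
  have hZd := (Matrix.isUnit_iff_isUnit_det _).1 hZ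
  have hB : B₁ = B₂ := by
    have h := congrArg (fun M => (Xᵀ * X)⁻¹ * (Xᵀ * M)) heq
    simp only [Matrix.mul_add, ← Matrix.mul_assoc Xᵀ, hΓ₁, hΓ₂, hU₁, hU₂,
      Matrix.zero_mul, Matrix.mul_zero, add_zero,
      Matrix.nonsing_inv_mul_cancel_left _ _ hXd] at h
    exact Matrix.transpose_injective h
  subst hB
  have hV₁' : V₁ᵀ * Z = 0 := by
    simpa using congrArg Matrix.transpose hV₁
  have hV₂' : V₂ᵀ * Z = 0 := by
    simpa using congrArg Matrix.transpose hV₂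
  rw [add_assoc, add_assoc] at heq
  have heq' := add_left_cancel heq
  have hG : Γ₁ = Γ₂ := by
    have h := congrArg (fun M => M * Z * (Zᵀ * Z)⁻¹) heq'
    simp only [Matrix.add_mul, Matrix.mul_assoc _ _ Z, hV₁', hV₂',
      Matrix.zero_mul, Matrix.mul_zero, add_zero,
      Matrix.mul_nonsing_inv_cancel_right _ _ hZd] at h
    exact h
  subst hG
  exact ⟨rfl, rfl, add_left_cancel heq'⟩
end

section
/- Let U₁, U₂ be real n×d matrices and V₁, V₂ be real m×d matrices such that, for i = 1, 2: Vᵢᵀ Vᵢ = I_d, Uᵢᵀ Uᵢ is a diagonal matrix with strictly decreasing positive diagonal entries, and the first non-zero entry of each column of Vᵢ is positive. If U₁ V₁ᵀ = U₂ V₂ᵀ, then U₁ = U₂ and V₁ = V₂. -/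
open Matrix

/-- Identifiability of scores and loadings under condition (B1):
`VᵀV = I_d`, `UᵀU` diagonal with strictly decreasing positive diagonal entries,
and the first non-zero entry of each column of `V` is positive. -/
theorem identifiability_under_B1
    {n m d : ℕ}
    (U₁ U₂ : Matrix (Fin n) (Fin d) ℝ)
    (V₁ V₂ : Matrix (Fin m) (Fin d) ℝ)
    (hV₁orth : V₁ᵀ * V₁ = 1) (hV₂orth : V₂ᵀ * V₂ = 1)
    (hU₁diag : ∀ i j : Fin d, i ≠ j → (U₁ᵀ * U₁) i j = 0)
    (hU₂diag : ∀ i j : Fin d, i ≠ j → (U₂ᵀ * U₂) i j = 0)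
    (hU₁pos : ∀ i : Fin d, 0 < (U₁ᵀ * U₁) i i)
    (hU₂pos : ∀ i : Fin d, 0 < (U₂ᵀ * U₂) i i)
    (hU₁dec : ∀ i j : Fin d, i < j → (U₁ᵀ * U₁) j j < (U₁ᵀ * U₁) i i)
    (hU₂dec : ∀ i j : Fin d, i < j → (U₂ᵀ * U₂) j j < (U₂ᵀ * U₂) i i)
    (hV₁sign : ∀ k : Fin d, ∃ j : Fin m, (∀ i : Fin m, i < j → V₁ i k = 0) ∧ 0 < V₁ j k)
    (hV₂sign : ∀ k : Fin d, ∃ j : Fin m, (∀ i : Fin m, i < j → V₂ i k = 0) ∧ 0 < V₂ j k)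
    (heq : U₁ * V₁ᵀ = U₂ * V₂ᵀ) :
    U₁ = U₂ ∧ V₁ = V₂ := by
  set D₁ := U₁ᵀ * U₁ with hD₁
  set D₂ := U₂ᵀ * U₂ with hD₂
  set Q := V₁ᵀ * V₂ with hQ
  have e₁ : D₁ = diagonal (fun i => D₁ i i) := by
    ext i j
    by_cases h : i = j
    · subst h; simp
    · rw [diagonal_apply_ne _ h, hU₁diag i j h]
  have e₂ : D₂ = diagonal (fun i => D₂ i i) := by
    ext i j
    by_cases h : i = j
    · subst h; simp
    · rw [diagonal_apply_ne _ h, hU₂diag i j h]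
  have cancel : ∀ {p : ℕ} (A B : Matrix (Fin d) (Fin p) ℝ), D₁ * A = D₁ * B → A = B := by
    intro p A B h
    ext i j
    have h' := congrFun (congrFun h i) j
    rw [e₁, diagonal_mul, diagonal_mul] at h'
    exact mul_left_cancel₀ (hU₁pos i).ne' h'
  have hU₂ : U₂ = U₁ * Q := by
    calc U₂ = U₂ * (V₂ᵀ * V₂) := by rw [hV₂orth, Matrix.mul_one]
      _ = (U₂ * V₂ᵀ) * V₂ := by rw [Matrix.mul_assoc]
      _ = U₁ * Q := by rw [← heq, Matrix.mul_assoc]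
  have hV : V₁ᵀ = Q * V₂ᵀ := by
    apply cancel
    rw [hD₁, Matrix.mul_assoc, heq, hU₂]
    simp only [Matrix.mul_assoc]
  have hQQ : Q * Qᵀ = 1 := by
    rw [← hV₁orth]
    conv_rhs => rw [hV]
    rw [hQ, transpose_mul, transpose_transpose]
    simp only [Matrix.mul_assoc]
  have hQQ' : Qᵀ * Q = 1 := mul_eq_one_comm.mp hQQ
  have hDQ : D₁ * Q = Q * D₂ := by
    have : D₂ = Qᵀ * (D₁ * Q) := by
      rw [hD₂, hU₂, transpose_mul, hD₁]
      simp only [Matrix.mul_assoc]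
    rw [this, ← Matrix.mul_assoc Q Qᵀ, hQQ, Matrix.one_mul]
  have key : ∀ i j, Q i j ≠ 0 → D₁ i i = D₂ j j := by
    intro i j h
    have h' := congrFun (congrFun hDQ i) j
    rw [e₁, e₂, diagonal_mul, mul_diagonal, mul_comm] at h'
    exact mul_left_cancel₀ h h'
  have row : ∀ i, ∃ j, Q i j ≠ 0 := by
    intro i
    by_contra! h
    have h' := congrFun (congrFun hQQ i) i
    simp [Matrix.mul_apply, h] at h'
  have col : ∀ j, ∃ i, Q i j ≠ 0 := by
    intro j
    by_contra! h
    have h' := congrFun (congrFun hQQ' j) j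
    simp [Matrix.mul_apply, h] at h'
  have hDD : (fun i => -D₁ i i) = (fun i => -D₂ i i) := by
    refine (StrictMono.range_inj (fun i j h => neg_lt_neg (hU₁dec i j h))
      (fun i j h => neg_lt_neg (hU₂dec i j h))).mp ?_
    ext x
    constructor
    · rintro ⟨i, rfl⟩
      obtain ⟨j, hj⟩ := row i
      exact ⟨j, by simp only [key i j hj]⟩
    · rintro ⟨j, rfl⟩
      obtain ⟨i, hi⟩ := col j
      exact ⟨i, by simp only [key i j hi]⟩
  have hinj : ∀ i j, i ≠ j → Q i j = 0 := by
    intro i j hij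
    by_contra h
    have h1 := key i j h
    have h2 : -D₁ j j = -D₂ j j := congrFun hDD j
    rcases lt_or_gt_of_ne hij with h3 | h3
    · have := hU₁dec i j h3; linarith
    · have := hU₁dec j i h3; linarith
  have eQ : Q = diagonal (fun i => Q i i) := by
    ext i j
    by_cases h : i = j
    · subst h; simp
    · rw [diagonal_apply_ne _ h, hinj i j h]
  have hVe : ∀ i k, V₁ i k = Q k k * V₂ i k := by
    intro i k
    have h' := congrFun (congrFun hV k) i
    rw [eQ, diagonal_mul] at h'
    exact h'
  have hsq : ∀ k, Q k k * Q k k = 1 := by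
    intro k
    have h' := congrFun (congrFun hQQ k) k
    rw [eQ, diagonal_transpose, diagonal_mul_diagonal] at h'
    simpa using h'
  have hone : ∀ k, Q k k = 1 := by
    intro k
    rcases mul_self_eq_one_iff.mp (hsq k) with h | h
    · exact h
    · exfalso
      obtain ⟨a, ha, ha'⟩ := hV₁sign k
      obtain ⟨b, hb, hb'⟩ := hV₂sign k
      have h1 := hVe a k
      have h2 := hVe b k
      rw [h] at h1 h2
      rcases lt_trichotomy a b with hab | hab | hab
      · have := hb a hab; linarith
      · subst hab; linarith
      · have := ha b hab; linarith
  have hQ1 : Q = 1 := by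
    rw [eQ, ← diagonal_one]
    congr 1
    funext k
    exact hone k
  rw [hQ1] at hU₂ hV
  rw [Matrix.mul_one] at hU₂
  rw [Matrix.one_mul] at hV
  exact ⟨hU₂.symm, transpose_injective hV⟩
end

section
/- Let U₁, U₂ be real n×d matrices and V₁, V₂ be real m×d matrices such that, for i = 1, 2: Uᵢᵀ Uᵢ = I_d, Vᵢᵀ Vᵢ is a diagonal matrix with strictly decreasing positive diagonal entries, and the first non-zero entry of each column of Uᵢ is positive. If U₁ V₁ᵀ = U₂ V₂ᵀ, then U₁ = U₂ and V₁ = V₂. -/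
open Matrix

/-- Identifiability of scores and loadings under condition (B2):
`UᵀU = I_d`, `VᵀV` diagonal with strictly decreasing positive diagonal entries,
and the first non-zero entry of each column of `U` is positive. -/
theorem identifiability_under_B2
    {n m d : ℕ}
    (U₁ U₂ : Matrix (Fin n) (Fin d) ℝ)
    (V₁ V₂ : Matrix (Fin m) (Fin d) ℝ)
    (hU₁orth : U₁ᵀ * U₁ = 1) (hU₂orth : U₂ᵀ * U₂ = 1)
    (hV₁diag : ∀ i j : Fin d, i ≠ j → (V₁ᵀ * V₁) i j = 0)
    (hV₂diag : ∀ i j : Fin d, i ≠ j → (V₂ᵀ * V₂) i j = 0)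
    (hV₁pos : ∀ i : Fin d, 0 < (V₁ᵀ * V₁) i i)
    (hV₂pos : ∀ i : Fin d, 0 < (V₂ᵀ * V₂) i i)
    (hV₁dec : ∀ i j : Fin d, i < j → (V₁ᵀ * V₁) j j < (V₁ᵀ * V₁) i i)
    (hV₂dec : ∀ i j : Fin d, i < j → (V₂ᵀ * V₂) j j < (V₂ᵀ * V₂) i i)
    (hU₁sign : ∀ k : Fin d, ∃ j : Fin n, (∀ i : Fin n, i < j → U₁ i k = 0) ∧ 0 < U₁ j k)
    (hU₂sign : ∀ k : Fin d, ∃ j : Fin n, (∀ i : Fin n, i < j → U₂ i k = 0) ∧ 0 < U₂ j k)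
    (heq : U₁ * V₁ᵀ = U₂ * V₂ᵀ) :
    U₁ = U₂ ∧ V₁ = V₂ := by
  obtain ⟨Q, hQ⟩ : ∃ Q, Q = U₂ᵀ * U₁ := ⟨_, rfl⟩
  obtain ⟨a, ha⟩ : ∃ a : Fin d → ℝ, a = fun i => (V₁ᵀ * V₁) i i := ⟨_, rfl⟩
  obtain ⟨b, hb⟩ : ∃ b : Fin d → ℝ, b = fun i => (V₂ᵀ * V₂) i i := ⟨_, rfl⟩
  have hD1 : V₁ᵀ * V₁ = diagonal a := by
    ext i j
    by_cases h : i = j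
    · subst h; simp [ha]
    · rw [hV₁diag i j h, diagonal_apply_ne _ h]
  have hD2 : V₂ᵀ * V₂ = diagonal b := by
    ext i j
    by_cases h : i = j
    · subst h; simp [hb]
    · rw [hV₂diag i j h, diagonal_apply_ne _ h]
  have hapos : ∀ i, 0 < a i := by intro i; rw [ha]; exact hV₁pos i
  have hV2 : V₂ᵀ = Q * V₁ᵀ := by
    rw [hQ, Matrix.mul_assoc, heq, ← Matrix.mul_assoc, hU₂orth, Matrix.one_mul]
  have hV1 : V₁ᵀ = Qᵀ * V₂ᵀ := by
    rw [hQ, transpose_mul, transpose_transpose, Matrix.mul_assoc, ← heq, ← Matrix.mul_assoc,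
      hU₁orth, Matrix.one_mul]
  have hinv : diagonal a * diagonal (fun i => (a i)⁻¹) = (1 : Matrix (Fin d) (Fin d) ℝ) := by
    rw [diagonal_mul_diagonal, ← diagonal_one]
    congr 1
    funext i
    exact mul_inv_cancel₀ (hapos i).ne'
  have hU : U₁ = U₂ * Q := by
    have h1 : U₁ * diagonal a = U₂ * Q * diagonal a := by
      rw [← hD1, ← Matrix.mul_assoc, heq, hV2]
      simp only [Matrix.mul_assoc]
    have h2 := congrArg (fun M => M * diagonal (fun i => (a i)⁻¹)) h1
    simpa only [Matrix.mul_assoc, hinv, Matrix.mul_one] using h2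
  have hQQ : Qᵀ * Q = 1 := by
    rw [← hU₁orth, hU, transpose_mul, Matrix.mul_assoc, ← Matrix.mul_assoc U₂ᵀ, hU₂orth,
      Matrix.one_mul]
  have hQQ' : Q * Qᵀ = 1 := mul_eq_one_comm.mp hQQ
  have hV1' : V₁ = V₂ * Q := by
    have := congrArg transpose hV1
    simpa using this
  have hcomm : Q * diagonal a = diagonal b * Q := by
    rw [← hD1, ← hD2, ← Matrix.mul_assoc, ← hV2, hV1', Matrix.mul_assoc]
  have hent : ∀ i j, Q i j ≠ 0 → a j = b i := by
    intro i j hij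
    have h := congrFun (congrFun hcomm i) j
    rw [mul_diagonal, diagonal_mul, mul_comm] at h
    exact mul_right_cancel₀ hij h
  have hrow : ∀ i, ∃ j, Q i j ≠ 0 := by
    intro i
    by_contra! h
    have h1 := congrFun (congrFun hQQ' i) i
    simp [Matrix.mul_apply, h] at h1
  have hcol : ∀ j, ∃ i, Q i j ≠ 0 := by
    intro i
    by_contra! h
    have h1 := congrFun (congrFun hQQ i) i
    simp [Matrix.mul_apply, h] at h1
  have hma : StrictMono (fun i => - a i) := by
    intro i j hij
    have := hV₁dec i j hij
    simpa [ha] using this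
  have hmb : StrictMono (fun i => - b i) := by
    intro i j hij
    have := hV₂dec i j hij
    simpa [hb] using this
  have hab : (fun i => - a i) = (fun i => - b i) := by
    rw [← StrictMono.range_inj hma hmb]
    ext x
    constructor
    · rintro ⟨j, rfl⟩
      obtain ⟨i, hi⟩ := hcol j
      exact ⟨i, by simp [hent i j hi]⟩
    · rintro ⟨i, rfl⟩
      obtain ⟨j, hj⟩ := hrow i
      exact ⟨j, by simp [hent i j hj]⟩
  have hoff : ∀ i j, i ≠ j → Q i j = 0 := by
    intro i j hij
    by_contra h
    have h1 := hent i j h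
    have h2 := congrFun hab j
    exact hij (hmb.injective (by show - b i = - b j; linarith))
  have hQd : Q = diagonal (fun i => Q i i) := by
    ext i j
    by_cases h : i = j
    · subst h; simp
    · rw [hoff i j h, diagonal_apply_ne _ h]
  have hUe : ∀ i k, U₁ i k = U₂ i k * Q k k := by
    intro i k
    conv_lhs => rw [hU, hQd, mul_diagonal]
  have hsq : ∀ k, Q k k * Q k k = 1 := by
    intro k
    have h1 := congrFun (congrFun hQQ k) k
    rw [hQd, diagonal_transpose, diagonal_mul_diagonal] at h1
    simpa using h1
  have hone : ∀ k, Q k k = 1 := by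
    intro k
    rcases mul_self_eq_one_iff.mp (hsq k) with h | h
    · exact h
    · exfalso
      obtain ⟨j, hj0, hj⟩ := hU₁sign k
      obtain ⟨l, hl0, hl⟩ := hU₂sign k
      have e1 := hUe j k
      have e2 := hUe l k
      rw [h] at e1 e2
      rcases lt_trichotomy j l with hlt | rfl | hlt
      · have := hl0 j hlt
        rw [this] at e1; linarith
      · linarith
      · have := hj0 l hlt
        rw [this] at e2; linarith
  have hQ1 : Q = 1 := by
    rw [hQd, ← diagonal_one]
    congr 1
    funext i
    exact hone i
  rw [hQ1, Matrix.mul_one] at hU hV1'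
  exact ⟨hU, hV1'⟩
end

section
/- Let H_n = (1/n)(I_n − (1/n) 1_n 1_nᵀ), where 1_n is the all-ones column vector of length n. Let U₁, U₂ be real n×d matrices and V₁, V₂ be real m×d matrices (m ≥ d) such that, for i = 1, 2: Uᵢᵀ H_n Uᵢ = I_d, the d×d submatrix formed by the first d rows of Vᵢ is lower triangular with strictly positive diagonal entries (equivalently, (Vᵢ)_{jk} = 0 for all 1 ≤ j < k ≤ d and (Vᵢ)_{jj} > 0 for all 1 ≤ j ≤ d), and Vᵢᵀ Vᵢ is invertible. If U₁ V₁ᵀ = U₂ V₂ᵀ, then U₁ = U₂ and V₁ = V₂. -/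
open Matrix

/-- The centering matrix `H_n = (1/n)(I_n - (1/n) 1_n 1_nᵀ)`. -/
noncomputable def centeringMatrix (n : ℕ) : Matrix (Fin n) (Fin n) ℝ :=
  ((n : ℝ)⁻¹) • ((1 : Matrix (Fin n) (Fin n) ℝ) -
    ((n : ℝ)⁻¹) • Matrix.of (fun _ _ => (1 : ℝ)))

/-- Identifiability of scores and loadings under condition (B3):
`Uᵀ H_n U = I_d`, the first `d` rows of `V` form a lower triangular matrix with
strictly positive diagonal, and `VᵀV` is invertible. -/
theorem identifiability_under_B3
    {n m d : ℕ} (hmd : d ≤ m)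
    (U₁ U₂ : Matrix (Fin n) (Fin d) ℝ)
    (V₁ V₂ : Matrix (Fin m) (Fin d) ℝ)
    (hU₁ : U₁ᵀ * centeringMatrix n * U₁ = 1)
    (hU₂ : U₂ᵀ * centeringMatrix n * U₂ = 1)
    (hV₁tri : ∀ j k : Fin d, j < k → V₁ (Fin.castLE hmd j) k = 0)
    (hV₂tri : ∀ j k : Fin d, j < k → V₂ (Fin.castLE hmd j) k = 0)
    (hV₁pos : ∀ j : Fin d, 0 < V₁ (Fin.castLE hmd j) j)
    (hV₂pos : ∀ j : Fin d, 0 < V₂ (Fin.castLE hmd j) j)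
    (hV₁inv : IsUnit (V₁ᵀ * V₁)) (hV₂inv : IsUnit (V₂ᵀ * V₂))
    (heq : U₁ * V₁ᵀ = U₂ * V₂ᵀ) :
    U₁ = U₂ ∧ V₁ = V₂ := by
  have gram : V₁ * V₁ᵀ = V₂ * V₂ᵀ := by
    have h1 : (U₁ * V₁ᵀ)ᵀ * centeringMatrix n * (U₁ * V₁ᵀ) = V₁ * V₁ᵀ := by
      calc (U₁ * V₁ᵀ)ᵀ * centeringMatrix n * (U₁ * V₁ᵀ)
          = V₁ * (U₁ᵀ * centeringMatrix n * U₁) * V₁ᵀ := by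
            simp only [Matrix.transpose_mul, Matrix.transpose_transpose, Matrix.mul_assoc]
        _ = _ := by rw [hU₁, Matrix.mul_one]
    have h2 : (U₂ * V₂ᵀ)ᵀ * centeringMatrix n * (U₂ * V₂ᵀ) = V₂ * V₂ᵀ := by
      calc (U₂ * V₂ᵀ)ᵀ * centeringMatrix n * (U₂ * V₂ᵀ)
          = V₂ * (U₂ᵀ * centeringMatrix n * U₂) * V₂ᵀ := by
            simp only [Matrix.transpose_mul, Matrix.transpose_transpose, Matrix.mul_assoc]
        _ = _ := by rw [hU₂, Matrix.mul_one]
    rw [← h1, ← h2, heq]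
  have col : ∀ j : Fin d, ∀ i, V₁ i j = V₂ i j := by
    intro j
    induction j using WellFoundedLT.induction with
    | ind j ih =>
    have key : ∀ i, V₁ i j * V₁ (Fin.castLE hmd j) j = V₂ i j * V₂ (Fin.castLE hmd j) j := by
      intro i
      have h := congrFun (congrFun gram i) (Fin.castLE hmd j)
      simp only [Matrix.mul_apply, Matrix.transpose_apply] at h
      rw [← Finset.add_sum_erase _ _ (Finset.mem_univ j),
        ← Finset.add_sum_erase (a := j) _ (fun k => V₂ i k * V₂ (Fin.castLE hmd j) k)
          (Finset.mem_univ j)] at h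
      have hs : ∑ k ∈ Finset.univ.erase j, V₁ i k * V₁ (Fin.castLE hmd j) k
          = ∑ k ∈ Finset.univ.erase j, V₂ i k * V₂ (Fin.castLE hmd j) k := by
        refine Finset.sum_congr rfl fun k hk => ?_
        rcases lt_or_gt_of_ne (Finset.ne_of_mem_erase hk) with hlt | hgt
        · rw [ih k hlt, ih k hlt]
        · rw [hV₁tri j k hgt, hV₂tri j k hgt, mul_zero, mul_zero]
      rw [hs] at h
      exact add_right_cancel h
    have hd : V₁ (Fin.castLE hmd j) j = V₂ (Fin.castLE hmd j) j :=
      (mul_self_inj (hV₁pos j).le (hV₂pos j).le).1 (key _)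
    intro i
    have h := key i
    rw [hd] at h
    exact mul_right_cancel₀ (hV₂pos j).ne' h
  have hV : V₁ = V₂ := by
    ext i j
    exact col j i
  refine ⟨?_, hV⟩
  subst hV
  obtain ⟨W, hW⟩ := hV₁inv.exists_right_inv
  have h : U₁ * V₁ᵀ * V₁ * W = U₂ * V₁ᵀ * V₁ * W := by rw [heq]
  simpa only [Matrix.mul_assoc, ← Matrix.mul_assoc V₁ᵀ V₁ W, hW, Matrix.mul_one] using h
end

section
/- Let X be a real n×p matrix with XᵀX invertible and Z a real m×q matrix with ZᵀZ invertible. For i = 1, 2, let (Bᵢ, Γᵢ, Uᵢ, Vᵢ) with Bᵢ m×p, Γᵢ n×q, Uᵢ n×d, Vᵢ m×d satisfy: XᵀΓᵢ = 0, XᵀUᵢ = 0, ZᵀVᵢ = 0, Vᵢᵀ Vᵢ = I_d, Uᵢᵀ Uᵢ diagonal with strictly decreasing positive diagonal entries, and the first non-zero entry of each column of Vᵢ positive. If X B₁ᵀ + Γ₁ Zᵀ + U₁ V₁ᵀ = X B₂ᵀ + Γ₂ Zᵀ + U₂ V₂ᵀ, then B₁ = B₂, Γ₁ = Γ₂, U₁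 = U₂, and V₁ = V₂. -/
open Matrix

/-- Computational identifiability of the GMF model under conditions (A) and (B1). -/
theorem gmf_identifiability_A_B1
    {n m p q d : ℕ}
    (X : Matrix (Fin n) (Fin p) ℝ) (Z : Matrix (Fin m) (Fin q) ℝ)
    (hX : IsUnit (Xᵀ * X)) (hZ : IsUnit (Zᵀ * Z))
    (B₁ B₂ : Matrix (Fin m) (Fin p) ℝ)
    (Γ₁ Γ₂ : Matrix (Fin n) (Fin q) ℝ)
    (U₁ U₂ : Matrix (Fin n) (Fin d) ℝ)
    (V₁ V₂ : Matrix (Fin m) (Fin d) ℝ)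
    (hΓ₁ : Xᵀ * Γ₁ = 0) (hΓ₂ : Xᵀ * Γ₂ = 0)
    (hU₁ : Xᵀ * U₁ = 0) (hU₂ : Xᵀ * U₂ = 0)
    (hV₁ : Zᵀ * V₁ = 0) (hV₂ : Zᵀ * V₂ = 0)
    (hV₁orth : V₁ᵀ * V₁ = 1) (hV₂orth : V₂ᵀ * V₂ = 1)
    (hU₁diag : ∀ i j : Fin d, i ≠ j → (U₁ᵀ * U₁) i j = 0)
    (hU₂diag : ∀ i j : Fin d, i ≠ j → (U₂ᵀ * U₂) i j = 0)
    (hU₁pos : ∀ i : Fin d, 0 < (U₁ᵀ * U₁) i i)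
    (hU₂pos : ∀ i : Fin d, 0 < (U₂ᵀ * U₂) i i)
    (hU₁dec : ∀ i j : Fin d, i < j → (U₁ᵀ * U₁) j j < (U₁ᵀ * U₁) i i)
    (hU₂dec : ∀ i j : Fin d, i < j → (U₂ᵀ * U₂) j j < (U₂ᵀ * U₂) i i)
    (hV₁sign : ∀ k : Fin d, ∃ j : Fin m, (∀ i : Fin m, i < j → V₁ i k = 0) ∧ 0 < V₁ j k)
    (hV₂sign : ∀ k : Fin d, ∃ j : Fin m, (∀ i : Fin m, i < j → V₂ i k = 0) ∧ 0 < V₂ j k)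
    (heq : X * B₁ᵀ + Γ₁ * Zᵀ + U₁ * V₁ᵀ = X * B₂ᵀ + Γ₂ * Zᵀ + U₂ * V₂ᵀ) :
    B₁ = B₂ ∧ Γ₁ = Γ₂ ∧ U₁ = U₂ ∧ V₁ = V₂ := by
  -- cancellation of the regression parts
  have hB : B₁ = B₂ := by
    have h := congrArg (fun M => Xᵀ * M) heq
    simp only [Matrix.mul_add, ← Matrix.mul_assoc, hΓ₁, hΓ₂, hU₁, hU₂, Matrix.zero_mul,
      add_zero] at h
    obtain ⟨W, hW⟩ := hX.exists_left_inv
    have h2 := congrArg (fun M => W * M) h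
    simp only [← Matrix.mul_assoc] at h2
    rw [Matrix.mul_assoc W, hW, Matrix.one_mul, Matrix.one_mul] at h2
    exact Matrix.transpose_injective h2
  subst hB
  have hV₁' : V₁ᵀ * Z = 0 := by
    have := congrArg Matrix.transpose hV₁
    simpa [Matrix.transpose_mul] using this
  have hV₂' : V₂ᵀ * Z = 0 := by
    have := congrArg Matrix.transpose hV₂
    simpa [Matrix.transpose_mul] using this
  have hΓ : Γ₁ = Γ₂ := by
    have h := congrArg (fun M => M * Z) heq
    simp only [Matrix.add_mul, Matrix.mul_assoc, hV₁', hV₂', Matrix.mul_zero, add_zero] at h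
    have h1 := add_left_cancel h
    obtain ⟨W, hW⟩ := hZ.exists_right_inv
    have h2 := congrArg (fun M => M * W) h1
    rwa [Matrix.mul_assoc Γ₁, Matrix.mul_assoc Γ₂, hW, Matrix.mul_one, Matrix.mul_one] at h2
  subst hΓ
  have hUV : U₁ * V₁ᵀ = U₂ * V₂ᵀ := add_left_cancel heq
  -- names for the diagonals
  obtain ⟨a, ha⟩ : ∃ a : Fin d → ℝ, ∀ i, a i = (U₁ᵀ * U₁) i i := ⟨_, fun _ => rfl⟩
  obtain ⟨b, hb⟩ : ∃ b : Fin d → ℝ, ∀ i, b i = (U₂ᵀ * U₂) i i := ⟨_, fun _ => rfl⟩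
  have hD₁ : U₁ᵀ * U₁ = diagonal a := by
    ext i j
    by_cases hij : i = j
    · subst hij; rw [diagonal_apply_eq, ha]
    · rw [diagonal_apply_ne _ hij, hU₁diag i j hij]
  have hD₂ : U₂ᵀ * U₂ = diagonal b := by
    ext i j
    by_cases hij : i = j
    · subst hij; rw [diagonal_apply_eq, hb]
    · rw [diagonal_apply_ne _ hij, hU₂diag i j hij]
  simp only [← ha, ← hb] at hU₁pos hU₂pos hU₁dec hU₂dec
  have hVD : V₁ * diagonal a * V₁ᵀ = V₂ * diagonal b * V₂ᵀ := by
    have h : (U₁ * V₁ᵀ)ᵀ * (U₁ * V₁ᵀ) = (U₂ * V₂ᵀ)ᵀ * (U₂ * V₂ᵀ) := by rw [hUV]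
    simp only [Matrix.transpose_mul, Matrix.transpose_transpose] at h
    rw [← hD₁, ← hD₂]
    simpa only [Matrix.mul_assoc] using h
  obtain ⟨Q, hQ⟩ : ∃ Q : Matrix (Fin d) (Fin d) ℝ, Q = V₁ᵀ * V₂ := ⟨_, rfl⟩
  have hQt : Qᵀ = V₂ᵀ * V₁ := by
    rw [hQ, Matrix.transpose_mul, Matrix.transpose_transpose]
  have hU₁Q : U₁ = U₂ * Qᵀ := by
    rw [hQt, ← Matrix.mul_assoc, ← hUV, Matrix.mul_assoc, hV₁orth, Matrix.mul_one]
  have hU₂Q : U₂ = U₁ * Q := by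
    rw [hQ, ← Matrix.mul_assoc, hUV, Matrix.mul_assoc, hV₂orth, Matrix.mul_one]
  have hcomm : diagonal a * Q = Q * diagonal b := by
    have h := congrArg (fun M => V₁ᵀ * M * V₂) hVD
    have e1 : V₁ᵀ * (V₁ * diagonal a * V₁ᵀ) * V₂ = (V₁ᵀ * V₁) * (diagonal a * (V₁ᵀ * V₂)) := by
      simp only [Matrix.mul_assoc]
    have e2 : V₁ᵀ * (V₂ * diagonal b * V₂ᵀ) * V₂ = (V₁ᵀ * V₂) * diagonal b * (V₂ᵀ * V₂) := by
      simp only [Matrix.mul_assoc]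
    rw [e1, e2, hV₁orth, hV₂orth, Matrix.one_mul, Matrix.mul_one, ← hQ] at h
    exact h
  have hinv : diagonal a * diagonal (fun i => (a i)⁻¹) = 1 := by
    rw [diagonal_mul_diagonal, ← diagonal_one]
    congr 1; funext i; exact mul_inv_cancel₀ (hU₁pos i).ne'
  have hinv' : diagonal (fun i => (a i)⁻¹) * diagonal a = 1 := mul_eq_one_comm.mp hinv
  have hQQ : Q * Qᵀ = 1 := by
    have h : U₁ᵀ * U₁ = U₁ᵀ * U₁ * (Q * Qᵀ) := by
      conv_lhs => rw [hU₁Q, hU₂Q]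
      rw [← hU₂Q, ← hU₁Q, Matrix.mul_assoc U₁ᵀ, ← Matrix.mul_assoc U₁, ← hU₂Q, ← hU₁Q]
    rw [hD₁] at h
    have h2 := congrArg (fun M => diagonal (fun i => (a i)⁻¹) * M) h
    simp only [← Matrix.mul_assoc] at h2
    rw [hinv', Matrix.one_mul] at h2
    exact h2.symm
  have hQQ' : Qᵀ * Q = 1 := mul_eq_one_comm.mp hQQ
  have hent : ∀ i j, Q i j ≠ 0 → a i = b j := by
    intro i j hij
    have h := congrFun (congrFun hcomm i) j
    rw [diagonal_mul, mul_diagonal, mul_comm] at h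
    exact mul_left_cancel₀ hij h
  have hrow : ∀ i, ∃ j, Q i j ≠ 0 := by
    intro i
    by_contra! hc
    have h := congrFun (congrFun hQQ i) i
    simp [Matrix.mul_apply, hc] at h
  have hcol : ∀ j, ∃ i, Q i j ≠ 0 := by
    intro i
    by_contra! hc
    have h := congrFun (congrFun hQQ' i) i
    simp [Matrix.mul_apply, hc] at h
  have hab : a = b := by
    have hr : Set.range (fun i => - a i) = Set.range (fun i => - b i) := by
      ext x
      constructor
      · rintro ⟨i, rfl⟩
        obtain ⟨j, hj⟩ := hrow i
        exact ⟨j, by simp [hent i j hj]⟩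
      · rintro ⟨j, rfl⟩
        obtain ⟨i, hi⟩ := hcol j
        exact ⟨i, by simp [hent i j hi]⟩
    have h := (StrictMono.range_inj (f := fun i => - a i) (g := fun i => - b i)
      (fun i j hij => neg_lt_neg (hU₁dec i j hij))
      (fun i j hij => neg_lt_neg (hU₂dec i j hij))).mp hr
    funext i
    exact neg_injective (congrFun h i)
  subst hab
  have hinj : Function.Injective a := (show StrictAnti a from fun i j h => hU₁dec i j h).injective
  have hQdiag : Q = diagonal (fun i => Q i i) := by
    ext i j
    by_cases hij : i = j
    · subst hij; rw [diagonal_apply_eq]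
    · rw [diagonal_apply_ne _ hij]
      by_contra hne
      exact hij (hinj (hent i j hne))
  have hVQ : V₁ = V₂ * Qᵀ := by
    have h := congrArg (fun M => M * V₁) hVD
    simp only [Matrix.mul_assoc] at h
    rw [hV₁orth, Matrix.mul_one, ← hQt] at h
    have hc : diagonal a * Qᵀ = Qᵀ * diagonal a := by
      have := congrArg Matrix.transpose hcomm
      simpa [Matrix.transpose_mul] using this.symm
    rw [hc, ← Matrix.mul_assoc] at h
    have h2 := congrArg (fun M => M * diagonal (fun i => (a i)⁻¹)) h
    rwa [Matrix.mul_assoc, Matrix.mul_assoc, hinv, Matrix.mul_one, Matrix.mul_one] at h2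
  have hVe : ∀ i k, V₁ i k = V₂ i k * Q k k := by
    intro i k
    have h := congrFun (congrFun hVQ i) k
    rw [hQdiag, diagonal_transpose, mul_diagonal] at h
    exact h
  have hsq : ∀ k, Q k k * Q k k = 1 := by
    intro k
    have h := hQQ
    rw [hQdiag, diagonal_transpose, diagonal_mul_diagonal] at h
    have h' := congrFun (congrFun h k) k
    rwa [diagonal_apply_eq, one_apply_eq] at h'
  have hone : ∀ k, Q k k = 1 := by
    intro k
    obtain ⟨j₁, hz₁, hp₁⟩ := hV₁sign k
    obtain ⟨j₂, hz₂, hp₂⟩ := hV₂sign k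
    rcases lt_trichotomy j₁ j₂ with hlt | heq' | hgt
    · rw [hVe, hz₂ _ hlt, zero_mul] at hp₁
      exact absurd hp₁ (lt_irrefl _)
    · subst heq'
      rw [hVe] at hp₁
      have hpos := pos_of_mul_pos_right hp₁ hp₂.le
      nlinarith [hsq k]
    · have h0 := hz₁ _ hgt
      rw [hVe] at h0
      rcases mul_eq_zero.mp h0 with h | h
      · exact absurd h hp₂.ne'
      · have := hsq k
        rw [h] at this
        norm_num at this
  have hQ1 : Q = 1 := by
    rw [hQdiag, ← diagonal_one]
    congr 1; funext k; exact hone k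
  refine ⟨rfl, rfl, ?_, ?_⟩
  · rw [hU₁Q, hQ1, Matrix.transpose_one, Matrix.mul_one]
  · rw [hVQ, hQ1, Matrix.transpose_one, Matrix.mul_one]
end

section
/- Let X be a real n×p matrix with XᵀX invertible and Z a real m×q matrix with ZᵀZ invertible. For i = 1, 2, let (Bᵢ, Γᵢ, Uᵢ, Vᵢ) with Bᵢ m×p, Γᵢ n×q, Uᵢ n×d, Vᵢ m×d satisfy: XᵀΓᵢ = 0, XᵀUᵢ = 0, ZᵀVᵢ = 0, Uᵢᵀ Uᵢ = I_d, Vᵢᵀ Vᵢ diagonal with strictly decreasing positive diagonal entries, and the first non-zero entry of each column of Uᵢ positive. If X B₁ᵀ + Γ₁ Zᵀ + U₁ V₁ᵀ = X B₂ᵀ + Γ₂ Zᵀ + U₂ V₂ᵀ, then B₁ = B₂, Γ₁ = Γ₂, U₁ = U₂, and V₁ = V₂. -/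
open Matrix

/-- Computational identifiability of the GMF model under conditions (A) and (B2). -/
theorem gmf_identifiability_A_B2
    {n m p q d : ℕ}
    (X : Matrix (Fin n) (Fin p) ℝ) (Z : Matrix (Fin m) (Fin q) ℝ)
    (hX : IsUnit (Xᵀ * X)) (hZ : IsUnit (Zᵀ * Z))
    (B₁ B₂ : Matrix (Fin m) (Fin p) ℝ)
    (Γ₁ Γ₂ : Matrix (Fin n) (Fin q) ℝ)
    (U₁ U₂ : Matrix (Fin n) (Fin d) ℝ)
    (V₁ V₂ : Matrix (Fin m) (Fin d) ℝ)
    (hΓ₁ : Xᵀ * Γ₁ = 0) (hΓ₂ : Xᵀ * Γ₂ = 0)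
    (hU₁ : Xᵀ * U₁ = 0) (hU₂ : Xᵀ * U₂ = 0)
    (hV₁ : Zᵀ * V₁ = 0) (hV₂ : Zᵀ * V₂ = 0)
    (hU₁orth : U₁ᵀ * U₁ = 1) (hU₂orth : U₂ᵀ * U₂ = 1)
    (hV₁diag : ∀ i j : Fin d, i ≠ j → (V₁ᵀ * V₁) i j = 0)
    (hV₂diag : ∀ i j : Fin d, i ≠ j → (V₂ᵀ * V₂) i j = 0)
    (hV₁pos : ∀ i : Fin d, 0 < (V₁ᵀ * V₁) i i)
    (hV₂pos : ∀ i : Fin d, 0 < (V₂ᵀ * V₂) i i)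
    (hV₁dec : ∀ i j : Fin d, i < j → (V₁ᵀ * V₁) j j < (V₁ᵀ * V₁) i i)
    (hV₂dec : ∀ i j : Fin d, i < j → (V₂ᵀ * V₂) j j < (V₂ᵀ * V₂) i i)
    (hU₁sign : ∀ k : Fin d, ∃ j : Fin n, (∀ i : Fin n, i < j → U₁ i k = 0) ∧ 0 < U₁ j k)
    (hU₂sign : ∀ k : Fin d, ∃ j : Fin n, (∀ i : Fin n, i < j → U₂ i k = 0) ∧ 0 < U₂ j k)
    (heq : X * B₁ᵀ + Γ₁ * Zᵀ + U₁ * V₁ᵀ = X * B₂ᵀ + Γ₂ * Zᵀ + U₂ * V₂ᵀ) :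
    B₁ = B₂ ∧ Γ₁ = Γ₂ ∧ U₁ = U₂ ∧ V₁ = V₂ := by
  have hB : B₁ = B₂ := by
    have h := congrArg (fun M => Xᵀ * M) heq
    simp only [Matrix.mul_add, ← Matrix.mul_assoc, hΓ₁, hΓ₂, hU₁, hU₂, Matrix.zero_mul,
      add_zero] at h
    have hdet := (Matrix.isUnit_iff_isUnit_det _).1 hX
    have h2 := congrArg (fun M => (Xᵀ * X)⁻¹ * M) h
    simp only [Matrix.nonsing_inv_mul_cancel_left _ _ hdet] at h2
    exact Matrix.transpose_injective h2
  subst hB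
  have hV₁' : V₁ᵀ * Z = 0 := by
    have := congrArg Matrix.transpose hV₁
    simpa [Matrix.transpose_mul] using this
  have hV₂' : V₂ᵀ * Z = 0 := by
    have := congrArg Matrix.transpose hV₂
    simpa [Matrix.transpose_mul] using this
  have hG : Γ₁ = Γ₂ := by
    rw [add_assoc, add_assoc] at heq
    have h := congrArg (fun M => M * Z) (add_left_cancel heq)
    simp only [Matrix.add_mul, Matrix.mul_assoc, hV₁', hV₂', Matrix.mul_zero,
      add_zero] at h
    have hdet := (Matrix.isUnit_iff_isUnit_det _).1 hZ
    have h2 := congrArg (fun M => M * (Zᵀ * Z)⁻¹) h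
    simpa only [Matrix.mul_nonsing_inv_cancel_right _ _ hdet] using h2
  subst hG
  have hUV : U₁ * V₁ᵀ = U₂ * V₂ᵀ := add_left_cancel heq
  have hD₁ : V₁ᵀ * V₁ = diagonal (fun i => (V₁ᵀ * V₁) i i) := by
    ext i j
    by_cases h : i = j
    · subst h; simp
    · rw [hV₁diag i j h, diagonal_apply_ne _ h]
  have hD₂ : V₂ᵀ * V₂ = diagonal (fun i => (V₂ᵀ * V₂) i i) := by
    ext i j
    by_cases h : i = j
    · subst h; simp
    · rw [hV₂diag i j h, diagonal_apply_ne _ h]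
  generalize ha : (fun i => (V₁ᵀ * V₁) i i) = a at hD₁
  generalize hb : (fun i => (V₂ᵀ * V₂) i i) = b at hD₂
  have ha_anti : StrictAnti a := by
    intro i j hij; subst ha; exact hV₁dec i j hij
  have hb_anti : StrictAnti b := by
    intro i j hij; subst hb; exact hV₂dec i j hij
  have hb_pos : ∀ i, 0 < b i := by subst hb; exact hV₂pos
  have hMM : U₁ * diagonal a * U₁ᵀ = U₂ * diagonal b * U₂ᵀ := by
    have h : (U₁ * V₁ᵀ) * (U₁ * V₁ᵀ)ᵀ = (U₂ * V₂ᵀ) * (U₂ * V₂ᵀ)ᵀ := by rw [hUV]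
    rw [← hD₁, ← hD₂]
    simpa only [Matrix.transpose_mul, Matrix.transpose_transpose, Matrix.mul_assoc] using h
  obtain ⟨Q, hQ⟩ : ∃ Q, Q = U₁ᵀ * U₂ := ⟨_, rfl⟩
  have hU2b : U₁ * (diagonal a * Q) = U₂ * diagonal b := by
    have h := congrArg (fun M => M * U₂) hMM
    simp only [Matrix.mul_assoc, hU₂orth, Matrix.mul_one] at h
    rw [hQ]; exact h
  have hcomm : diagonal a * Q = Q * diagonal b := by
    have h := congrArg (fun M => U₁ᵀ * M) hU2b
    simp only [← Matrix.mul_assoc, hU₁orth, Matrix.one_mul] at h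
    rw [← hQ] at h; exact h
  have hUQ : U₁ * Q = U₂ := by
    rw [hcomm, ← Matrix.mul_assoc] at hU2b
    ext i k
    have h := congrFun (congrFun hU2b i) k
    rw [mul_diagonal, mul_diagonal] at h
    exact mul_right_cancel₀ (hb_pos k).ne' h
  have hQQ : Qᵀ * Q = 1 := by
    have h : (U₁ * Q)ᵀ * (U₁ * Q) = 1 := by rw [hUQ]; exact hU₂orth
    rw [Matrix.transpose_mul, Matrix.mul_assoc, ← Matrix.mul_assoc U₁ᵀ, hU₁orth,
      Matrix.one_mul] at h
    exact h
  have hQQ' : Q * Qᵀ = 1 := mul_eq_one_comm.1 hQQ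
  have hent : ∀ i j, Q i j ≠ 0 → a i = b j := by
    intro i j h
    have h1 := congrFun (congrFun hcomm i) j
    rw [mul_diagonal, diagonal_mul, mul_comm] at h1
    exact mul_left_cancel₀ h h1
  have hab : a = b := by
    have hr : Set.range a = Set.range b := by
      apply Set.Subset.antisymm
      · rintro _ ⟨i, rfl⟩
        by_contra hn
        have h1 := congrFun (congrFun hQQ' i) i
        rw [Matrix.mul_apply, Finset.sum_eq_zero, one_apply_eq] at h1
        · exact zero_ne_one h1
        · intro j _
          have : Q i j = 0 := by
            by_contra h; exact hn ⟨j, (hent i j h).symm⟩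
          rw [this, zero_mul]
      · rintro _ ⟨j, rfl⟩
        by_contra hn
        have h1 := congrFun (congrFun hQQ j) j
        rw [Matrix.mul_apply, Finset.sum_eq_zero, one_apply_eq] at h1
        · exact zero_ne_one h1
        · intro i _
          have : Q i j = 0 := by
            by_contra h; exact hn ⟨i, hent i j h⟩
          rw [this, mul_zero]
    exact (StrictAnti.range_inj ha_anti hb_anti).1 hr
  subst hab
  have hQd : ∀ i j, i ≠ j → Q i j = 0 := by
    intro i j hij
    by_contra h
    exact hij (ha_anti.injective (hent i j h))
  have hUe : ∀ i k, U₂ i k = U₁ i k * Q k k := by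
    intro i k
    rw [← hUQ, Matrix.mul_apply, Finset.sum_eq_single k]
    · intro j _ hj; rw [hQd j k hj, mul_zero]
    · simp
  have hsq : ∀ k, Q k k * Q k k = 1 := by
    intro k
    have h := congrFun (congrFun hQQ k) k
    rw [Matrix.mul_apply, Finset.sum_eq_single k, one_apply_eq] at h
    · exact h
    · intro j _ hj; rw [hQd j k hj, mul_zero]
    · simp
  have hone : ∀ k, Q k k = 1 := by
    intro k
    rcases mul_self_eq_one_iff.1 (hsq k) with h | h
    · exact h
    · exfalso
      obtain ⟨j₁, hz₁, hp₁⟩ := hU₁sign k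
      obtain ⟨j₂, hz₂, hp₂⟩ := hU₂sign k
      have e₁ := hUe j₁ k
      have e₂ := hUe j₂ k
      rw [h] at e₁ e₂
      rcases lt_trichotomy j₁ j₂ with hl | hl | hl
      · have := hz₂ j₁ hl; linarith
      · subst hl; linarith
      · have := hz₁ j₂ hl; linarith
  have hU : U₁ = U₂ := by
    ext i k
    rw [hUe, hone, mul_one]
  subst hU
  refine ⟨rfl, rfl, rfl, ?_⟩
  have h := congrArg (fun M => U₁ᵀ * M) hUV
  simp only [← Matrix.mul_assoc, hU₁orth, Matrix.one_mul] at h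
  exact Matrix.transpose_injective h
end

section
/- Let X be a real n×p matrix with XᵀX invertible, Z a real m×q matrix with ZᵀZ invertible, and H_n = (1/n)(I_n − (1/n) 1_n 1_nᵀ). For i = 1, 2, let (Bᵢ, Γᵢ, Uᵢ, Vᵢ) with Bᵢ m×p, Γᵢ n×q, Uᵢ n×d, Vᵢ m×d (m ≥ d) satisfy: XᵀΓᵢ = 0, XᵀUᵢ = 0, ZᵀVᵢ = 0, Uᵢᵀ H_n Uᵢ = I_d, (Vᵢ)_{jk} = 0 for all 1 ≤ j < k ≤ d, (Vᵢ)_{jj} > 0 for all 1 ≤ j ≤ d, and Vᵢᵀ Vᵢ invertible. If X B₁ᵀ + Γ₁ Zᵀ + U₁ V₁ᵀ = X B₂ᵀ + Γ₂ Zᵀ + U₂ V₂ᵀ, then B₁ = B₂, Γ₁ = Γ₂, U₁ = U₂, and V₁ = V₂. -/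
open Matrix

theorem gmf_lower_orth {d : ℕ} (L₁ L₂ Q : Matrix (Fin d) (Fin d) ℝ)
    (h₁ : ∀ j k : Fin d, j < k → L₁ j k = 0) (h₂ : ∀ j k : Fin d, j < k → L₂ j k = 0)
    (p₁ : ∀ j, 0 < L₁ j j) (p₂ : ∀ j, 0 < L₂ j j)
    (hQ : Q * Qᵀ = 1) (h : L₂ = L₁ * Q) : Q = 1 := by
  have t₁ : L₁.BlockTriangular OrderDual.toDual := fun i j hij => h₁ i j hij
  have t₂ : L₂.BlockTriangular OrderDual.toDual := fun i j hij => h₂ i j hij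
  have d₁ : IsUnit L₁.det := by
    rw [Matrix.det_of_lowerTriangular L₁ t₁]
    exact (Finset.prod_pos fun i _ => p₁ i).ne'.isUnit
  have d₂ : IsUnit L₂.det := by
    rw [Matrix.det_of_lowerTriangular L₂ t₂]
    exact (Finset.prod_pos fun i _ => p₂ i).ne'.isUnit
  haveI := Matrix.invertibleOfIsUnitDet L₁ d₁
  haveI := Matrix.invertibleOfIsUnitDet L₂ d₂
  have hq : Q = L₁⁻¹ * L₂ := by
    rw [h, ← Matrix.mul_assoc, Matrix.nonsing_inv_mul _ d₁, Matrix.one_mul]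
  have hqt : Qᵀ = L₂⁻¹ * L₁ := by
    have : L₂ * Qᵀ = L₁ := by rw [h, Matrix.mul_assoc, hQ, Matrix.mul_one]
    rw [← this, ← Matrix.mul_assoc, Matrix.nonsing_inv_mul _ d₂, Matrix.one_mul]
  have tq : Q.BlockTriangular OrderDual.toDual := by
    rw [hq]; exact (Matrix.blockTriangular_inv_of_blockTriangular t₁).mul t₂
  have tqt : Qᵀ.BlockTriangular OrderDual.toDual := by
    rw [hqt]; exact (Matrix.blockTriangular_inv_of_blockTriangular t₂).mul t₁
  have off : ∀ i j, i ≠ j → Q i j = 0 := by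
    intro i j hij
    rcases lt_or_gt_of_ne hij with hl | hl
    · exact tq (show OrderDual.toDual j < OrderDual.toDual i from hl)
    · exact tqt (show OrderDual.toDual i < OrderDual.toDual j from hl)
  ext i j
  by_cases hij : i = j
  · subst hij
    have e1 : L₂ i i = L₁ i i * Q i i := by
      rw [h, Matrix.mul_apply]
      exact Finset.sum_eq_single i (fun b _ hb => by rw [off b i hb, mul_zero]) (by simp)
    have e2 : Q i i * Q i i = 1 := by
      have := congrFun (congrFun hQ i) i
      rw [Matrix.mul_apply, Matrix.one_apply_eq] at this
      rw [← this]
      symm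
      exact Finset.sum_eq_single i
        (fun b _ hb => by rw [off i b (Ne.symm hb), zero_mul]) (by simp)
    have e3 : 0 < Q i i := by
      have := p₂ i
      rw [e1] at this
      exact (pos_iff_pos_of_mul_pos this).1 (p₁ i)
    rw [Matrix.one_apply_eq]
    nlinarith
  · rw [off i j hij, Matrix.one_apply_ne hij]

/-- Computational identifiability of the GMF model under conditions (A) and (B3). -/
theorem gmf_identifiability_A_B3
    {n m p q d : ℕ} (hmd : d ≤ m)
    (X : Matrix (Fin n) (Fin p) ℝ) (Z : Matrix (Fin m) (Fin q) ℝ)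
    (hX : IsUnit (Xᵀ * X)) (hZ : IsUnit (Zᵀ * Z))
    (B₁ B₂ : Matrix (Fin m) (Fin p) ℝ)
    (Γ₁ Γ₂ : Matrix (Fin n) (Fin q) ℝ)
    (U₁ U₂ : Matrix (Fin n) (Fin d) ℝ)
    (V₁ V₂ : Matrix (Fin m) (Fin d) ℝ)
    (hΓ₁ : Xᵀ * Γ₁ = 0) (hΓ₂ : Xᵀ * Γ₂ = 0)
    (hU₁ : Xᵀ * U₁ = 0) (hU₂ : Xᵀ * U₂ = 0)
    (hV₁ : Zᵀ * V₁ = 0) (hV₂ : Zᵀ * V₂ = 0)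
    (hU₁H : U₁ᵀ * centeringMatrix n * U₁ = 1)
    (hU₂H : U₂ᵀ * centeringMatrix n * U₂ = 1)
    (hV₁tri : ∀ j k : Fin d, j < k → V₁ (Fin.castLE hmd j) k = 0)
    (hV₂tri : ∀ j k : Fin d, j < k → V₂ (Fin.castLE hmd j) k = 0)
    (hV₁pos : ∀ j : Fin d, 0 < V₁ (Fin.castLE hmd j) j)
    (hV₂pos : ∀ j : Fin d, 0 < V₂ (Fin.castLE hmd j) j)
    (hV₁inv : IsUnit (V₁ᵀ * V₁)) (hV₂inv : IsUnit (V₂ᵀ * V₂))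
    (heq : X * B₁ᵀ + Γ₁ * Zᵀ + U₁ * V₁ᵀ = X * B₂ᵀ + Γ₂ * Zᵀ + U₂ * V₂ᵀ) :
    B₁ = B₂ ∧ Γ₁ = Γ₂ ∧ U₁ = U₂ ∧ V₁ = V₂ := by
  have hB : B₁ = B₂ := by
    have h := congrArg (fun M => Xᵀ * M) heq
    simp only [Matrix.mul_add, ← Matrix.mul_assoc, hΓ₁, hΓ₂, hU₁, hU₂, Matrix.zero_mul,
      add_zero] at h
    have hd := (Matrix.isUnit_iff_isUnit_det _).1 hX
    have h' := congrArg (fun M => (Xᵀ * X)⁻¹ * M) h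
    simp only [← Matrix.mul_assoc (Xᵀ * X)⁻¹ (Xᵀ * X), Matrix.nonsing_inv_mul _ hd,
      Matrix.one_mul] at h'
    exact Matrix.transpose_injective h'
  subst hB
  have hG : Γ₁ = Γ₂ := by
    have h := congrArg (fun M => M * Z) heq
    have z₁ : V₁ᵀ * Z = 0 := by
      rw [← Matrix.transpose_transpose Z, ← Matrix.transpose_mul, hV₁, Matrix.transpose_zero]
    have z₂ : V₂ᵀ * Z = 0 := by
      rw [← Matrix.transpose_transpose Z, ← Matrix.transpose_mul, hV₂, Matrix.transpose_zero]
    simp only [Matrix.add_mul, Matrix.mul_assoc, z₁, z₂, Matrix.mul_zero,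
      add_zero, add_right_inj] at h
    have hd := (Matrix.isUnit_iff_isUnit_det _).1 hZ
    have h' := congrArg (fun M => M * (Zᵀ * Z)⁻¹) h
    simpa only [Matrix.mul_assoc Γ₁, Matrix.mul_assoc Γ₂, Matrix.mul_nonsing_inv _ hd,
      Matrix.mul_one] using h'
  subst hG
  have hUV : U₁ * V₁ᵀ = U₂ * V₂ᵀ := add_left_cancel heq
  have hd := (Matrix.isUnit_iff_isUnit_det _).1 hV₁inv
  obtain ⟨R, hR⟩ : ∃ R : Matrix (Fin d) (Fin d) ℝ, U₁ = U₂ * R := by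
    refine ⟨V₂ᵀ * V₁ * (V₁ᵀ * V₁)⁻¹, ?_⟩
    rw [← Matrix.mul_assoc, ← Matrix.mul_assoc, ← hUV, Matrix.mul_assoc U₁, Matrix.mul_assoc,
      Matrix.mul_nonsing_inv _ hd, Matrix.mul_one]
  have hRR : Rᵀ * R = 1 := by
    rw [← hU₁H, hR, Matrix.transpose_mul]
    calc Rᵀ * R = Rᵀ * (U₂ᵀ * centeringMatrix n * U₂) * R := by rw [hU₂H, Matrix.mul_one]
      _ = _ := by simp only [Matrix.mul_assoc]
  have hVt : R * V₁ᵀ = V₂ᵀ := by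
    calc R * V₁ᵀ = (U₂ᵀ * centeringMatrix n * U₂) * (R * V₁ᵀ) := by rw [hU₂H, Matrix.one_mul]
      _ = U₂ᵀ * centeringMatrix n * (U₁ * V₁ᵀ) := by rw [hR]; simp only [Matrix.mul_assoc]
      _ = (U₂ᵀ * centeringMatrix n * U₂) * V₂ᵀ := by rw [hUV]; simp only [Matrix.mul_assoc]
      _ = V₂ᵀ := by rw [hU₂H, Matrix.one_mul]
  have hV : V₂ = V₁ * Rᵀ := by
    rw [← Matrix.transpose_transpose V₂, ← hVt, Matrix.transpose_mul, Matrix.transpose_transpose]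
  have hR1 : Rᵀ = 1 := by
    refine gmf_lower_orth (V₁.submatrix (Fin.castLE hmd) id) (V₂.submatrix (Fin.castLE hmd) id) Rᵀ
      hV₁tri hV₂tri hV₁pos hV₂pos (by rw [Matrix.transpose_transpose]; exact hRR) ?_
    rw [hV]
    ext i j
    simp [Matrix.mul_apply]
  have hR2 : R = 1 := by
    rw [← Matrix.transpose_transpose R, hR1, Matrix.transpose_one]
  refine ⟨rfl, rfl, ?_, ?_⟩
  · rw [hR, hR2, Matrix.mul_one]
  · rw [hV, hR1, Matrix.mul_one]
end
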